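/- arXiv:2501.10032 — 2 statements merged into one kernel-verified Lean document; each statement's English description precedes it below -/
import Mathlib

section
/- Let X ⊆ ℝ^m be a semilinear set such that Z = fcl(X) is a flat with dim(Z) = dim(X) = d, and suppose that the half-flat H ⊆ Z is essential for X. Then: (a) if a ∈ Z witnesses that H is essential for X, then a ∈ esb(X); (b) the set of points witnessing that H is essential for X has dimension d − 1; (c) bd(H) ⊆ fcl(esb(X)). -/
open Classical

/-- A basic semilinear set: the solution set of a finite system of linear
equations and (strict or weak) linear inequalities with real coefficients. -/
def IsBasicSemilinear {E : Type*} [AddCommGroup E] [Module ℝ E] (S : Set E) : Prop :=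
  ∃ (k : ℕ) (f : Fin k → E →ₗ[ℝ] ℝ) (c : Fin k → ℝ) (rel : Fin k → ℝ → ℝ → Prop),
    (∀ i, rel i = (· = ·) ∨ rel i = (· < ·) ∨ rel i = (· ≤ ·)) ∧
    S = {x | ∀ i, rel i (f i x) (c i)}

/-- A semilinear set: a finite union of basic semilinear sets. -/
def IsSemilinear {E : Type*} [AddCommGroup E] [Module ℝ E] (S : Set E) : Prop :=
  ∃ (N : ℕ) (T : Fin N → Set E), (∀ j, IsBasicSemilinear (T j)) ∧ S = ⋃ j, T j

/-- A flat: the solution set of a finite system of linear equations. -/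
def IsFlat {E : Type*} [AddCommGroup E] [Module ℝ E] (Z : Set E) : Prop :=
  ∃ (k : ℕ) (f : Fin k → E →ₗ[ℝ] ℝ) (c : Fin k → ℝ), Z = {x | ∀ i, f i x = c i}

/-- A closed set in the flat topology: a finite union of flats. -/
def IsFlatClosed {E : Type*} [AddCommGroup E] [Module ℝ E] (C : Set E) : Prop :=
  ∃ (N : ℕ) (Z : Fin N → Set E), (∀ j, IsFlat (Z j)) ∧ C = ⋃ j, Z j

/-- The closure of `X` in the flat topology. -/
def fcl {E : Type*} [AddCommGroup E] [Module ℝ E] (X : Set E) : Set E :=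
  ⋂₀ {C | IsFlatClosed C ∧ X ⊆ C}

/-- The o-minimal dimension of `X ⊆ ℝ^m`: the largest `d` such that the image
of `X` under some coordinate projection `ℝ^m → ℝ^d` has nonempty interior,
with `dim ∅ = ⊥ (= −∞)`. -/
noncomputable def sldim {m : ℕ} (X : Set (Fin m → ℝ)) : WithBot ℤ :=
  if X = ∅ then ⊥ else
    (((sSup {d : ℕ | ∃ s : Fin d → Fin m, Function.Injective s ∧
      (interior ((fun x (j : Fin d) => x (s j)) '' X)).Nonempty} : ℕ) : ℤ) : WithBot ℤ)

/-- The local dimension of `X` at `a`: the infimum of `dim (U ∩ X)` over open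
neighborhoods `U` of `a`. -/
noncomputable def sldimAt {m : ℕ} (X : Set (Fin m → ℝ)) (a : Fin m → ℝ) : WithBot ℤ :=
  sInf {n : WithBot ℤ | ∃ U : Set (Fin m → ℝ), IsOpen U ∧ a ∈ U ∧ n = sldim (U ∩ X)}

/-- The open cube centered at `a` of half side length `r`. -/
def cube {m : ℕ} (a : Fin m → ℝ) (r : ℝ) : Set (Fin m → ℝ) :=
  {x | ∀ j, |x j - a j| < r}

/-- The boundary of `X` relative to the flat `Z`: points of `Z` every open
cube around which meets both `X` and `Z ∖ X`. -/
def bdIn {m : ℕ} (Z X : Set (Fin m → ℝ)) : Set (Fin m → ℝ) :=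
  {a | a ∈ Z ∧ ∀ r : ℝ, 0 < r →
    (cube a r ∩ X).Nonempty ∧ (cube a r ∩ (Z \ X)).Nonempty}

/-- The essential boundary of `X` relative to the flat `Z`: points `a ∈ Z`
with `dim_a(Z ∩ X) = dim_a(Z ∖ X) = dim_a(Z) = dim Z`. -/
def esbIn {m : ℕ} (Z X : Set (Fin m → ℝ)) : Set (Fin m → ℝ) :=
  {a | a ∈ Z ∧ sldimAt (Z ∩ X) a = sldim Z ∧ sldimAt (Z \ X) a = sldim Z ∧
    sldimAt Z a = sldim Z}

/-- A half-flat of the flat `Z`: a nonempty proper subset of `Z` of the form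
`{a ∈ Z : λ(a) < c}` or `{a ∈ Z : λ(a) ≤ c}`. -/
def IsHalfFlatOf {E : Type*} [AddCommGroup E] [Module ℝ E] (Z H : Set E) : Prop :=
  H.Nonempty ∧ H ≠ Z ∧ ∃ (f : E →ₗ[ℝ] ℝ) (c : ℝ),
    H = {a ∈ Z | f a < c} ∨ H = {a ∈ Z | f a ≤ c}

/-- A closed half-flat of the flat `Z`. -/
def IsClosedHalfFlatOf {E : Type*} [AddCommGroup E] [Module ℝ E] (Z H : Set E) : Prop :=
  H.Nonempty ∧ H ≠ Z ∧ ∃ (f : E →ₗ[ℝ] ℝ) (c : ℝ), H = {a ∈ Z | f a ≤ c}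

/-- `a` witnesses that the half-flat `H ⊆ Z` is essential for `X`:
`a ∈ bd(H)` and some open cube `C` centered at `a` has `X ∩ C = H ∩ C`. -/
def WitnessEssential {m : ℕ} (Z X H : Set (Fin m → ℝ)) (a : Fin m → ℝ) : Prop :=
  a ∈ bdIn Z H ∧ ∃ r : ℝ, 0 < r ∧ X ∩ cube a r = H ∩ cube a r

/-- The half-flat `H ⊆ Z` is essential for `X`. -/
def EssentialFor {m : ℕ} (Z X H : Set (Fin m → ℝ)) : Prop :=
  ∃ a, WitnessEssential Z X H a

/-- The coordinate projection selecting the coordinates `s`. -/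
def coordProj {m n : ℕ} (s : Fin n → Fin m) : (Fin m → ℝ) →ₗ[ℝ] (Fin n → ℝ) :=
  LinearMap.funLeft ℝ ℝ s

theorem cube_eq_ball {m : ℕ} (a : Fin m → ℝ) {r : ℝ} (hr : 0 < r) :
    cube a r = Metric.ball a r := by
  ext x
  simp [cube, dist_pi_lt_iff hr, Real.dist_eq]

/-- Some choice of `finrank V` coordinates restricts to a surjection on `V`. -/
theorem exists_coordProj_map_eq_top {m : ℕ} (V : Submodule ℝ (Fin m → ℝ)) :
    ∃ s : Fin (Module.finrank ℝ V) → Fin m, Function.Injective s ∧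
      V.map (coordProj s) = ⊤ := by
  obtain ⟨κ, a, ha, hspan, hli⟩ := exists_linearIndependent' (K := ℝ)
    (fun i : Fin m => (LinearMap.proj i : (Fin m → ℝ) →ₗ[ℝ] ℝ) ∘ₗ V.subtype)
  have hfin : Finite κ := Finite.of_injective a ha
  have := Fintype.ofFinite κ
  have hinj : ∀ v : V, (∀ k, (v : Fin m → ℝ) (a k) = 0) → v = 0 := by
    intro v hv
    ext i
    have hi : (LinearMap.proj i : (Fin m → ℝ) →ₗ[ℝ] ℝ) ∘ₗ V.subtype ∈
        LinearMap.ker (Module.Dual.eval ℝ V v) := by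
      have hmem := Submodule.subset_span (R := ℝ) (Set.mem_range_self
        (f := fun i : Fin m => (LinearMap.proj i : (Fin m → ℝ) →ₗ[ℝ] ℝ) ∘ₗ V.subtype) i)
      rw [← hspan] at hmem
      refine Submodule.span_le.2 ?_ hmem
      rintro _ ⟨k, rfl⟩
      simpa using hv k
    simpa using hi
  have hcard : Fintype.card κ = Module.finrank ℝ V := by
    apply le_antisymm
    · have := hli.fintype_card_le_finrank
      rwa [Subspace.dual_finrank_eq] at this
    · let L : V →ₗ[ℝ] (κ → ℝ) := LinearMap.funLeft ℝ ℝ a ∘ₗ V.subtype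
      have hL : Function.Injective L := by
        rw [injective_iff_map_eq_zero]
        intro v hv
        exact hinj v fun k => congrFun hv k
      simpa using LinearMap.finrank_le_finrank_of_injective hL
  let e : Fin (Module.finrank ℝ V) ≃ κ := (Fintype.equivFinOfCardEq hcard).symm
  refine ⟨a ∘ e, ha.comp e.injective, ?_⟩
  have hL : Function.Injective (coordProj (a ∘ e) ∘ₗ V.subtype) := by
    rw [injective_iff_map_eq_zero]
    intro v hv
    refine hinj v fun k => ?_
    have := congrFun hv (e.symm k)
    simpa [coordProj, LinearMap.funLeft_apply] using this
  have hsurj := (LinearMap.injective_iff_surjective_of_finrank_eq_finrank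
    (by simp : Module.finrank ℝ V = Module.finrank ℝ (Fin (Module.finrank ℝ V) → ℝ))).1 hL
  rw [eq_top_iff]
  intro y _
  obtain ⟨v, rfl⟩ := hsurj y
  exact ⟨v, v.2, rfl⟩

/-- A nonempty relatively open subset of the affine subspace `a + V` has dimension `finrank V`. -/
theorem sldim_relOpen {m : ℕ} (V : Submodule ℝ (Fin m → ℝ)) (a : Fin m → ℝ)
    {O S : Set (Fin m → ℝ)} (hO : IsOpen O) (hS : ∀ x, x ∈ S ↔ x - a ∈ V ∧ x ∈ O)
    (hne : S.Nonempty) : sldim S = ((Module.finrank ℝ V : ℤ) : WithBot ℤ) := by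
  rw [sldim, if_neg hne.ne_empty]
  congr 2
  apply IsGreatest.csSup_eq
  constructor
  · obtain ⟨s, hs, htop⟩ := exists_coordProj_map_eq_top V
    refine ⟨s, hs, ?_⟩
    let L : V →ₗ[ℝ] (Fin (Module.finrank ℝ V) → ℝ) := coordProj s ∘ₗ V.subtype
    have hsurj : Function.Surjective L := by
      intro y
      obtain ⟨v, hv, rfl⟩ := (htop ▸ Submodule.mem_top : y ∈ V.map (coordProj s))
      exact ⟨⟨v, hv⟩, rfl⟩
    have hopen : IsOpen (L '' {v : V | a + v ∈ O}) := by
      refine L.isOpenMap_of_finiteDimensional hsurj _ ?_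
      exact hO.preimage (by fun_prop : Continuous fun v : V => a + (v : Fin m → ℝ))
    have heq : (fun x (j : Fin (Module.finrank ℝ V)) => x (s j)) '' S =
        (fun y => coordProj s a + y) '' (L '' {v : V | a + v ∈ O}) := by
      ext y
      constructor
      · rintro ⟨x, hx, rfl⟩
        obtain ⟨h1, h2⟩ := (hS x).1 hx
        refine ⟨_, ⟨⟨x - a, h1⟩, by simpa using h2, rfl⟩, ?_⟩
        ext j
        simp [L, coordProj, LinearMap.funLeft_apply]
      · rintro ⟨_, ⟨v, hv, rfl⟩, rfl⟩
        refine ⟨a + v, (hS _).2 ⟨by simp, hv⟩, ?_⟩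
        ext j
        simp [L, coordProj, LinearMap.funLeft_apply]
    have hopen' := (isOpenMap_add_left (coordProj s a)) _ hopen
    rw [heq, hopen'.interior_eq, ← heq]
    exact hne.image _
  · rintro n ⟨s, -, hne_int⟩
    have hsub : (fun x (j : Fin n) => x (s j)) '' S ⊆
        (Homeomorph.addLeft (coordProj s a)) '' (V.map (coordProj s) : Set (Fin n → ℝ)) := by
      rintro _ ⟨x, hx, rfl⟩
      refine ⟨coordProj s (x - a), ⟨_, ((hS x).1 hx).1, rfl⟩, ?_⟩
      ext j
      simp [coordProj, LinearMap.funLeft_apply]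
    have hne' := hne_int.mono (interior_mono hsub)
    rw [← Homeomorph.image_interior, Set.image_nonempty] at hne'
    have htop := Submodule.eq_top_of_nonempty_interior' _ hne'
    have := Submodule.finrank_map_le (coordProj s) V
    rw [htop] at this
    simpa using this

theorem sldim_mono {m : ℕ} {S T : Set (Fin m → ℝ)} (h : S ⊆ T) : sldim S ≤ sldim T := by
  by_cases hS : S = ∅
  · simp [sldim, hS]
  have hT : T ≠ ∅ := fun hT => hS (Set.subset_empty_iff.1 (hT ▸ h))
  rw [sldim, sldim, if_neg hS, if_neg hT]
  norm_cast
  refine csSup_le_csSup ⟨m, ?_⟩ ?_ ?_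
  · rintro n ⟨s, hs, -⟩
    simpa using Fintype.card_le_of_injective s hs
  · obtain ⟨x, hx⟩ := Set.nonempty_iff_ne_empty.2 hS
    refine ⟨0, Fin.elim0, fun i => i.elim0, ?_⟩
    have : ((fun x (j : Fin 0) => x (Fin.elim0 j)) '' S : Set (Fin 0 → ℝ)) = Set.univ :=
      Set.eq_univ_of_forall fun y => ⟨x, hx, Subsingleton.elim _ _⟩
    rw [this, interior_univ]
    exact Set.univ_nonempty
  · rintro n ⟨s, hs, hne_int⟩
    exact ⟨s, hs, hne_int.mono (interior_mono (Set.image_mono h))⟩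

theorem sldimAt_eq_of_forall {m : ℕ} {S : Set (Fin m → ℝ)} {a : Fin m → ℝ} {n : WithBot ℤ}
    (h : ∀ U, IsOpen U → a ∈ U → sldim (U ∩ S) = n) : sldimAt S a = n := by
  have : {k : WithBot ℤ | ∃ U : Set (Fin m → ℝ), IsOpen U ∧ a ∈ U ∧ k = sldim (U ∩ S)} = {n} := by
    ext k
    constructor
    · rintro ⟨U, hU, ha, rfl⟩
      exact h U hU ha
    · rintro rfl
      exact ⟨Set.univ, isOpen_univ, trivial, (h _ isOpen_univ trivial).symm⟩
  rw [sldimAt, this, csInf_singleton]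

theorem exists_pos_add_smul_mem {m : ℕ} {U : Set (Fin m → ℝ)} (hU : IsOpen U) {a : Fin m → ℝ}
    (ha : a ∈ U) (v : Fin m → ℝ) : ∃ ε : ℝ, 0 < ε ∧ ∀ t, |t| < ε → a + t • v ∈ U := by
  have hc : Continuous fun t : ℝ => a + t • v := by fun_prop
  obtain ⟨ε, hε, h⟩ := Metric.isOpen_iff.1 (hU.preimage hc) 0 (by simpa using ha)
  exact ⟨ε, hε, fun t ht => h (by simpa using ht)⟩

theorem IsFlat.exists_submodule {E : Type*} [AddCommGroup E] [Module ℝ E] {Z : Set E}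
    (hZ : IsFlat Z) : ∃ V : Submodule ℝ E, ∀ a ∈ Z, ∀ x, x ∈ Z ↔ x - a ∈ V := by
  obtain ⟨k, f, c, rfl⟩ := hZ
  refine ⟨⨅ i, LinearMap.ker (f i), fun a ha x => ?_⟩
  simp only [Set.mem_ofPred_eq, Submodule.mem_iInf, LinearMap.mem_ker, map_sub, sub_eq_zero] at ha ⊢
  simp [ha]

/-- A half-flat lies between an open and a closed half-space of `Z`, cut out by a functional that
increases along some direction of `Z`. -/
theorem IsHalfFlatOf.exists_functional {E : Type*} [AddCommGroup E] [Module ℝ E] {Z H : Set E}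
    (hH : IsHalfFlatOf Z H) : ∃ (f : E →ₗ[ℝ] ℝ) (c : ℝ), H ⊆ Z ∧ (∀ x ∈ H, f x ≤ c) ∧
      (∀ x ∈ Z, f x < c → x ∈ H) ∧ ∃ x ∈ Z, ∃ y ∈ Z, f x < f y := by
  obtain ⟨⟨x, hx⟩, hne, f, c, h⟩ := hH
  have hsub : H ⊆ Z := by rcases h with rfl | rfl <;> exact fun _ h => h.1
  obtain ⟨y, hy, hyH⟩ := Set.exists_of_ssubset (hsub.ssubset_of_ne hne)
  rcases h with rfl | rfl
  · refine ⟨f, c, hsub, fun z hz => hz.2.le, fun z hz h => ⟨hz, h⟩, x, hx.1, y, hy, ?_⟩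
    exact hx.2.trans_le (not_lt.1 fun h => hyH ⟨hy, h⟩)
  · refine ⟨f, c, hsub, fun z hz => hz.2, fun z hz h => ⟨hz, h.le⟩, x, hx.1, y, hy, ?_⟩
    exact hx.2.trans_lt (not_le.1 fun h => hyH ⟨hy, h⟩)

/-- The boundary of a half-flat is the hyperplane of `Z` that cuts it out. -/
theorem mem_bdIn_iff {m : ℕ} {Z H : Set (Fin m → ℝ)} {V : Submodule ℝ (Fin m → ℝ)}
    (hV : ∀ a ∈ Z, ∀ x, x ∈ Z ↔ x - a ∈ V) {f : (Fin m → ℝ) →ₗ[ℝ] ℝ} {c : ℝ}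
    (hle : ∀ x ∈ H, f x ≤ c) (hlt : ∀ x ∈ Z, f x < c → x ∈ H)
    {v : Fin m → ℝ} (hv : v ∈ V) (hfv : 0 < f v) (x : Fin m → ℝ) :
    x ∈ bdIn Z H ↔ x ∈ Z ∧ f x = c := by
  have hf : Continuous f := f.continuous_of_finiteDimensional
  constructor
  · rintro ⟨hxZ, h⟩
    refine ⟨hxZ, le_antisymm ?_ ?_⟩
    · by_contra! hlt'
      obtain ⟨r, hr, hb⟩ := Metric.isOpen_iff.1 (isOpen_lt continuous_const hf) x hlt'
      obtain ⟨y, hy, hyH⟩ := (h r hr).1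
      rw [cube_eq_ball x hr] at hy
      exact absurd (hle y hyH) (not_le.2 (hb hy))
    · by_contra! hlt'
      obtain ⟨r, hr, hb⟩ := Metric.isOpen_iff.1 (isOpen_lt hf continuous_const) x hlt'
      obtain ⟨y, hy, hyZ, hyH⟩ := (h r hr).2
      rw [cube_eq_ball x hr] at hy
      exact hyH (hlt y hyZ (hb hy))
  · rintro ⟨hxZ, hx⟩
    refine ⟨hxZ, fun r hr => ?_⟩
    rw [cube_eq_ball x hr]
    obtain ⟨ε, hε, h⟩ := exists_pos_add_smul_mem Metric.isOpen_ball (Metric.mem_ball_self hr) v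
    have hZ : ∀ t : ℝ, x + t • v ∈ Z := fun t =>
      (hV x hxZ _).2 (by simpa using V.smul_mem t hv)
    refine ⟨⟨x + (-(ε / 2)) • v, h _ ?_, hlt _ (hZ _) ?_⟩,
      ⟨x + (ε / 2) • v, h _ ?_, hZ _, fun hH => ?_⟩⟩
    · rw [abs_neg, abs_of_pos (by positivity)]; linarith
    · simp only [map_add, map_smul, smul_eq_mul, hx]
      nlinarith
    · rw [abs_of_pos (by positivity)]; linarith
    · have := hle _ hH
      simp only [map_add, map_smul, smul_eq_mul, hx] at this
      nlinarith

theorem isOpen_setOf_eq_on_cube {m : ℕ} (X H : Set (Fin m → ℝ)) :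
    IsOpen {x | ∃ r : ℝ, 0 < r ∧ X ∩ cube x r = H ∩ cube x r} := by
  rw [Metric.isOpen_iff]
  rintro x ⟨r, hr, h⟩
  rw [cube_eq_ball x hr] at h
  refine ⟨r / 2, by positivity, fun y hy => ⟨r / 2, by positivity, ?_⟩⟩
  rw [cube_eq_ball y (by positivity)]
  have hsub : Metric.ball y (r / 2) ⊆ Metric.ball x r :=
    Metric.ball_subset_ball' (by rw [Metric.mem_ball] at hy; linarith)
  rw [← Set.inter_eq_self_of_subset_right hsub, ← Set.inter_assoc, h, Set.inter_assoc]

/-- A finite union of flats containing a segment germ contains the whole line. -/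
theorem IsFlatClosed.add_mem {E : Type*} [AddCommGroup E] [Module ℝ E] {C : Set E}
    (hC : IsFlatClosed C) {a v : E} {ε : ℝ} (hε : 0 < ε)
    (h : ∀ t : ℝ, |t| < ε → a + t • v ∈ C) : a + v ∈ C := by
  obtain ⟨N, F, hF, rfl⟩ := hC
  have hmem : ∀ t : Set.Ioo 0 ε, ∃ j, a + (t : ℝ) • v ∈ F j := fun t =>
    Set.mem_iUnion.1 (h t (by rw [abs_of_pos t.2.1]; exact t.2.2))
  choose j hj using hmem
  have : Infinite (Set.Ioo 0 ε) := (Set.Ioo_infinite hε).to_subtype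
  obtain ⟨s, t, hst, hjst⟩ := Finite.exists_ne_map_eq_of_infinite j
  have hs := hj s
  rw [hjst] at hs
  have ht := hj t
  refine Set.mem_iUnion.2 ⟨j t, ?_⟩
  obtain ⟨k, f, c, hfc⟩ := hF (j t)
  rw [hfc] at hs ht ⊢
  intro i
  have h1 := hs i
  have h2 := ht i
  simp only [map_add, map_smul, smul_eq_mul] at h1 h2 ⊢
  have h3 : ((s : ℝ) - t) * f i v = 0 := by linarith
  have h4 : f i v = 0 :=
    (mul_eq_zero.1 h3).resolve_left (sub_ne_zero.2 fun h => hst (Subtype.ext h))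
  rw [h4] at h1 ⊢
  linarith

/-- A hyperplane of `V` has codimension one. -/
theorem finrank_inf_ker_add_one {E : Type*} [AddCommGroup E] [Module ℝ E] [FiniteDimensional ℝ E]
    (V : Submodule ℝ E) (f : E →ₗ[ℝ] ℝ) {v : E} (hv : v ∈ V) (hfv : f v ≠ 0) :
    Module.finrank ℝ (V ⊓ LinearMap.ker f : Submodule ℝ E) + 1 = Module.finrank ℝ V := by
  let g : V →ₗ[ℝ] ℝ := f ∘ₗ V.subtype
  have hg : LinearMap.range g = ⊤ :=
    LinearMap.range_eq_top.2 (LinearMap.surjective fun h =>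
      hfv (by simpa [g] using LinearMap.congr_fun h ⟨v, hv⟩))
  have hker : (LinearMap.ker g).map V.subtype = V ⊓ LinearMap.ker f := by
    ext x
    simp [g, and_comm]
  have h := g.finrank_range_add_finrank_ker
  rw [hg, finrank_top, Module.finrank_self] at h
  rw [← hker, Submodule.finrank_map_subtype_eq]
  omega

/-- Every neighborhood of a witness meets both `X` and `Z \ X` in full dimension. -/
theorem WitnessEssential.mem_esbIn {m : ℕ} {X Z H : Set (Fin m → ℝ)} {a : Fin m → ℝ}
    (hw : WitnessEssential Z X H a) {V : Submodule ℝ (Fin m → ℝ)}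
    (hV : ∀ a ∈ Z, ∀ x, x ∈ Z ↔ x - a ∈ V) {f : (Fin m → ℝ) →ₗ[ℝ] ℝ} {c : ℝ}
    (hle : ∀ x ∈ H, f x ≤ c) (hlt : ∀ x ∈ Z, f x < c → x ∈ H)
    {v : Fin m → ℝ} (hv : v ∈ V) (hfv : 0 < f v) : a ∈ esbIn Z X := by
  obtain ⟨ha, r, hr, heq⟩ := hw
  rw [cube_eq_ball a hr] at heq
  obtain ⟨haZ, hac⟩ := (mem_bdIn_iff hV hle hlt hv hfv a).1 ha
  have hf : Continuous f := f.continuous_of_finiteDimensional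
  have hZdim : sldim Z = ((Module.finrank ℝ V : ℤ) : WithBot ℤ) :=
    sldim_relOpen V a isOpen_univ (fun x => by simp [hV a haZ]) ⟨a, haZ⟩
  have key : ∀ (S O : Set (Fin m → ℝ)), S ⊆ Z → IsOpen O → Z ∩ O ⊆ S →
      (Z ∩ O).Nonempty → sldim S = sldim Z := by
    intro S O hSZ hO hOS hne
    refine le_antisymm (sldim_mono hSZ) ?_
    rw [hZdim, ← sldim_relOpen V a hO (S := Z ∩ O) (fun x => by
      rw [Set.mem_inter_iff, hV a haZ]) hne]
    exact sldim_mono hOS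
  have hline : ∀ t : ℝ, a + t • v ∈ Z := fun t =>
    (hV a haZ _).2 (by simpa using V.smul_mem t hv)
  refine ⟨haZ, sldimAt_eq_of_forall fun U hU haU => ?_, sldimAt_eq_of_forall fun U hU haU => ?_,
    sldimAt_eq_of_forall fun U hU haU => ?_⟩
  · obtain ⟨ε, hε, h⟩ := exists_pos_add_smul_mem (hU.inter Metric.isOpen_ball)
      ⟨haU, Metric.mem_ball_self hr⟩ v
    refine key _ ((U ∩ Metric.ball a r) ∩ {x | f x < c}) (fun x hx => hx.2.1)
      ((hU.inter Metric.isOpen_ball).inter (isOpen_lt hf continuous_const)) ?_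
      ⟨a + (-(ε / 2)) • v, hline _, h _ ?_, ?_⟩
    · rintro x ⟨hxZ, ⟨hxU, hxr⟩, hxc⟩
      exact ⟨hxU, hxZ, (heq.symm ▸ ⟨hlt x hxZ hxc, hxr⟩ : x ∈ X ∩ Metric.ball a r).1⟩
    · rw [abs_neg, abs_of_pos (by positivity)]; linarith
    · simp only [Set.mem_ofPred_eq, map_add, map_smul, smul_eq_mul, hac]
      nlinarith
  · obtain ⟨ε, hε, h⟩ := exists_pos_add_smul_mem (hU.inter Metric.isOpen_ball)
      ⟨haU, Metric.mem_ball_self hr⟩ v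
    refine key _ ((U ∩ Metric.ball a r) ∩ {x | c < f x}) (fun x hx => hx.2.1)
      ((hU.inter Metric.isOpen_ball).inter (isOpen_lt continuous_const hf)) ?_
      ⟨a + (ε / 2) • v, hline _, h _ ?_, ?_⟩
    · rintro x ⟨hxZ, ⟨hxU, hxr⟩, hxc⟩
      refine ⟨hxU, hxZ, fun hxX => ?_⟩
      exact absurd (hle x (heq ▸ ⟨hxX, hxr⟩ : x ∈ H ∩ Metric.ball a r).1) (not_le.2 hxc)
    · rw [abs_of_pos (by positivity)]; linarith
    · simp only [Set.mem_ofPred_eq, map_add, map_smul, smul_eq_mul, hac]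
      nlinarith
  · exact key _ U Set.inter_subset_right hU (fun x hx => ⟨hx.2, hx.1⟩) ⟨a, haZ, haU⟩

/-- for a semilinear `X` with `fcl X = Z` a flat,
`dim Z = dim X = d`, and a half-flat `H ⊆ Z` essential for `X`:
(a) every witness lies in `esb(X)`; (b) the set of witnesses has dimension
`d − 1`; (c) `bd(H) ⊆ fcl(esb(X))`. -/
theorem essential_witness_props {m : ℕ} (X : Set (Fin m → ℝ)) (hX : IsSemilinear X)
    (Z : Set (Fin m → ℝ)) (hZ : IsFlat Z) (hfcl : fcl X = Z) (d : ℕ)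
    (hdZ : sldim Z = (d : ℤ)) (hdX : sldim X = (d : ℤ))
    (H : Set (Fin m → ℝ)) (hH : IsHalfFlatOf Z H) (hess : EssentialFor Z X H) :
    (∀ a, WitnessEssential Z X H a → a ∈ esbIn Z X) ∧
    sldim {a | WitnessEssential Z X H a} = (((d : ℤ) - 1 : ℤ) : WithBot ℤ) ∧
    bdIn Z H ⊆ fcl (esbIn Z X) := by
  obtain ⟨V, hV⟩ := hZ.exists_submodule
  obtain ⟨f, c, -, hle, hlt, x, hx, y, hy, hxy⟩ := hH.exists_functional
  have hv : y - x ∈ V := (hV x hx y).1 hy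
  have hfv : 0 < f (y - x) := by rw [map_sub]; linarith
  have hbd := mem_bdIn_iff hV hle hlt hv hfv
  have hesb : ∀ a, WitnessEssential Z X H a → a ∈ esbIn Z X :=
    fun a ha => ha.mem_esbIn hV hle hlt hv hfv
  obtain ⟨a, ha⟩ := hess
  obtain ⟨haZ, hac⟩ := (hbd a).1 ha.1
  refine ⟨hesb, ?_, ?_⟩
  · have hZdim : sldim Z = ((Module.finrank ℝ V : ℤ) : WithBot ℤ) :=
      sldim_relOpen V a isOpen_univ (fun x => by simp [hV a haZ]) ⟨a, haZ⟩
    have hd : (Module.finrank ℝ V : ℤ) = d := by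
      rw [hZdim] at hdZ
      exact_mod_cast hdZ
    rw [sldim_relOpen (V ⊓ LinearMap.ker f) a (isOpen_setOf_eq_on_cube X H)
      (S := {a | WitnessEssential Z X H a}) (fun z => ?_) ⟨a, ha⟩]
    · have := finrank_inf_ker_add_one V f hv hfv.ne'
      congr 1
      omega
    · simp [WitnessEssential, hbd, hV a haZ, sub_eq_zero, hac]
  · rintro b hb C ⟨hC, hsub⟩
    obtain ⟨hbZ, hbc⟩ := (hbd b).1 hb
    obtain ⟨ε, hε, h⟩ := exists_pos_add_smul_mem (isOpen_setOf_eq_on_cube X H) ha.2 (b - a)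
    have := hC.add_mem hε fun t ht => hsub (hesb (a + t • (b - a)) ⟨(hbd _).2 ⟨?_, ?_⟩, h t ht⟩)
    · simpa using this
    · exact (hV a haZ _).2 (by simpa using V.smul_mem t ((hV a haZ b).1 hbZ))
    · simp [hac, hbc]
end

section
/- Let X ⊆ ℝ^m be a semilinear set and suppose Z = fcl(X) is a flat with dim(Z) = d > 0. Let H ⊆ Z be a closed half-flat such that dim(X ∩ bd(H) ∩ esb(X) ∩ esb(X ∩ H)) = d − 1. Then H is essential for X. -/
open Classical

theorem IsFlat.exists_affineSubspace {E : Type*} [AddCommGroup E] [Module ℝ E] {Z : Set E}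
    (hZ : IsFlat Z) : ∃ A : AffineSubspace ℝ E, (A : Set E) = Z := by
  obtain ⟨k, f, c, rfl⟩ := hZ
  refine ⟨⟨{x | ∀ i, f i x = c i}, ?_⟩, rfl⟩
  intro t p q r hp hq hr i
  simp [hp i, hq i, hr i]

theorem exists_affineSubspace_inter_levelSet {E : Type*} [AddCommGroup E] [Module ℝ E]
    (A : AffineSubspace ℝ E) (g : E →ₗ[ℝ] ℝ) (c : ℝ) :
    ∃ B : AffineSubspace ℝ E, ∀ x, x ∈ B ↔ x ∈ A ∧ g x = c := by
  obtain ⟨L, hL⟩ := IsFlat.exists_affineSubspace (Z := {x | g x = c})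
    ⟨1, fun _ => g, fun _ => c, by simp⟩
  refine ⟨A ⊓ L, fun x => ?_⟩
  rw [AffineSubspace.mem_inf_iff, ← SetLike.mem_coe (p := L), hL]
  rfl

theorem bddAbove_projection_dims {m : ℕ} (S : Set (Fin m → ℝ)) :
    BddAbove {d : ℕ | ∃ s : Fin d → Fin m, Function.Injective s ∧
      (interior ((fun x (j : Fin d) => x (s j)) '' S)).Nonempty} := by
  refine ⟨m, ?_⟩
  rintro d ⟨s, hs, -⟩
  simpa using Fintype.card_le_of_injective s hs

theorem exists_projection_of_le_sldim {m : ℕ} {S : Set (Fin m → ℝ)} {n : ℕ}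
    (h : ((n : ℤ) : WithBot ℤ) ≤ sldim S) :
    ∃ e, n ≤ e ∧ ∃ s : Fin e → Fin m,
      (interior ((fun x (j : Fin e) => x (s j)) '' S)).Nonempty := by
  rcases S.eq_empty_or_nonempty with rfl | hS
  · simp [sldim] at h
  · rw [sldim, if_neg hS.ne_empty, WithBot.coe_le_coe, Nat.cast_le] at h
    have hmem := Nat.sSup_mem (s := {d : ℕ | ∃ s : Fin d → Fin m, Function.Injective s ∧
      (interior ((fun x (j : Fin d) => x (s j)) '' S)).Nonempty}) ?_ (bddAbove_projection_dims S)
    · obtain ⟨s, -, hs⟩ := hmem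
      exact ⟨_, h, s, hs⟩
    · refine ⟨0, Fin.elim0, fun i => i.elim0, ?_⟩
      obtain ⟨x, hx⟩ := hS
      have : (fun x (j : Fin 0) => x (Fin.elim0 j : Fin m)) '' S = Set.univ := by
        ext y
        exact ⟨fun _ => trivial, fun _ => ⟨x, hx, Subsingleton.elim _ _⟩⟩
      rw [this, interior_univ]
      exact Set.univ_nonempty

/-- A set of dimension at least `n` that is covered by finitely many affine subspaces is covered
using at least one nonempty affine subspace of dimension at least `n`. -/
theorem exists_le_finrank_of_le_sldim {m : ℕ} {ι : Type*} [Finite ι] {S : Set (Fin m → ℝ)} {n : ℕ}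
    (h : ((n : ℤ) : WithBot ℤ) ≤ sldim S) (F : ι → AffineSubspace ℝ (Fin m → ℝ))
    (hF : S ⊆ ⋃ i, (F i : Set (Fin m → ℝ))) :
    ∃ i, (F i : Set (Fin m → ℝ)).Nonempty ∧ n ≤ Module.finrank ℝ (F i).direction := by
  obtain ⟨e, hne, s, hs⟩ := exists_projection_of_le_sldim h
  let π : (Fin m → ℝ) →ₗ[ℝ] (Fin e → ℝ) := LinearMap.funLeft ℝ ℝ s
  have hcover : interior (π '' S) ⊆ ⋃ i, ((F i).map π.toAffineMap : Set (Fin e → ℝ)) := by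
    refine interior_subset.trans ?_
    rintro _ ⟨x, hx, rfl⟩
    obtain ⟨i, hi⟩ := Set.mem_iUnion.1 (hF hx)
    exact Set.mem_iUnion.2 ⟨i, x, hi, rfl⟩
  have htop : ∃ i, (F i).map π.toAffineMap = ⊤ := by
    by_contra! hne_top
    refine (isOpen_interior.measure_pos MeasureTheory.volume hs).ne' ?_
    refine MeasureTheory.measure_mono_null hcover (MeasureTheory.measure_iUnion_null fun i => ?_)
    exact MeasureTheory.Measure.addHaar_affineSubspace _ _ (hne_top i)
  obtain ⟨i, hi⟩ := htop
  refine ⟨i, ?_, hne.trans ?_⟩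
  · have h0 : (0 : Fin e → ℝ) ∈ (F i).map π.toAffineMap := by
      rw [hi]
      exact AffineSubspace.mem_top ℝ _ _
    obtain ⟨x, hx, -⟩ := h0
    exact ⟨x, hx⟩
  · have hdir := AffineSubspace.map_direction π.toAffineMap (F i)
    rw [hi, AffineSubspace.direction_top] at hdir
    have hle := Submodule.finrank_map_le π.toAffineMap.linear (F i).direction
    rw [← hdir, finrank_top] at hle
    simpa using hle

/-- Some coordinate projection maps a given subspace onto a space of the same dimension. -/
theorem exists_surjective_coordinates {m : ℕ} (V : Submodule ℝ (Fin m → ℝ)) :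
    ∃ s : Fin (Module.finrank ℝ V) → Fin m, Function.Injective s ∧
      Function.Surjective (LinearMap.funLeft ℝ ℝ s ∘ₗ V.subtype) := by
  let φ : Fin m → Module.Dual ℝ V := fun i => LinearMap.proj i ∘ₗ V.subtype
  have hφ : Submodule.span ℝ (Set.range φ) = ⊤ := by
    refine Submodule.span_eq_top_of_ne_zero fun z hz => ?_
    by_contra! hall
    exact hz (Subtype.ext (funext fun i => hall (φ i) ⟨i, rfl⟩))
  obtain ⟨κ, a, ha, hspan, hli⟩ := exists_linearIndependent' ℝ φ
  rw [hφ] at hspan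
  have : Finite κ := Finite.of_injective a ha
  have := Fintype.ofFinite κ
  have hcard : Fintype.card κ = Module.finrank ℝ V := by
    rw [← Subspace.dual_finrank_eq,
      Module.finrank_eq_card_basis (Module.Basis.mk hli hspan.ge)]
  let e : Fin (Module.finrank ℝ V) ≃ κ := (Fintype.equivFinOfCardEq hcard).symm
  refine ⟨a ∘ e, ha.comp e.injective, ?_⟩
  rw [← LinearMap.injective_iff_surjective_of_finrank_eq_finrank (by simp),
    ← LinearMap.ker_eq_bot, LinearMap.ker_eq_bot']
  intro v hv
  have hker : (⊤ : Submodule ℝ (Module.Dual ℝ V)) ≤ LinearMap.ker (Module.Dual.eval ℝ V v) := by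
    rw [← hspan, Submodule.span_le]
    rintro _ ⟨k, rfl⟩
    simpa [φ, LinearMap.funLeft] using congrFun hv (e.symm k)
  exact (Module.forall_dual_apply_eq_zero_iff ℝ v).1 fun g => hker (Submodule.mem_top (x := g))

theorem finrank_direction_le_sldim {m : ℕ} {A : AffineSubspace ℝ (Fin m → ℝ)}
    (hA : (A : Set (Fin m → ℝ)).Nonempty) :
    ((Module.finrank ℝ A.direction : ℤ) : WithBot ℤ) ≤ sldim (A : Set (Fin m → ℝ)) := by
  rw [sldim, if_neg hA.ne_empty, WithBot.coe_le_coe, Nat.cast_le]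
  refine le_csSup (bddAbove_projection_dims _) ?_
  obtain ⟨s, hs, hsurj⟩ := exists_surjective_coordinates A.direction
  refine ⟨s, hs, ?_⟩
  obtain ⟨p, hp⟩ := hA
  suffices h : (fun x (j : Fin _) => x (s j)) '' (A : Set (Fin m → ℝ)) = Set.univ by
    rw [h, interior_univ]
    exact Set.univ_nonempty
  refine Set.eq_univ_of_forall fun y => ?_
  obtain ⟨v, hv⟩ := hsurj (y - fun j => p (s j))
  refine ⟨v.1 +ᵥ p, AffineSubspace.vadd_mem_of_mem_direction v.2 hp, funext fun j => ?_⟩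
  have := congrFun hv j
  simp [LinearMap.funLeft] at this
  simp [this]

theorem finrank_direction_lt_of_lt {m : ℕ} {A B : AffineSubspace ℝ (Fin m → ℝ)}
    (h : A < B) (hA : (A : Set (Fin m → ℝ)).Nonempty) :
    Module.finrank ℝ A.direction < Module.finrank ℝ B.direction :=
  Submodule.finrank_lt_finrank_of_lt (AffineSubspace.direction_lt_of_nonempty h hA)

theorem sldimAt_le {m : ℕ} {S U : Set (Fin m → ℝ)} {a : Fin m → ℝ} (hU : IsOpen U) (ha : a ∈ U) :
    sldimAt S a ≤ sldim (U ∩ S) :=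
  csInf_le (OrderBot.bddBelow _) ⟨U, hU, ha, rfl⟩

/-- A linear equation that holds on the hyperplane `f = c` of an affine subspace `A` is, on `A`,
a multiple of the equation `f = c`. -/
theorem exists_sub_eq_mul_sub {E : Type*} [AddCommGroup E] [Module ℝ E]
    {A : AffineSubspace ℝ E} {f g : E →ₗ[ℝ] ℝ} {c e : ℝ} {a z : E} (ha : a ∈ A) (hfa : f a = c)
    (hz : z ∈ A) (hfz : c < f z) (hg : ∀ x ∈ A, f x = c → g x = e) :
    ∃ μ : ℝ, ∀ x ∈ A, g x - e = μ * (f x - c) := by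
  refine ⟨(g z - e) / (f z - c), fun x hx => ?_⟩
  have hpos : f z - c ≠ 0 := (sub_pos.2 hfz).ne'
  have hmem := A.smul_vsub_vadd_mem (-((f x - c) / (f z - c))) hz ha hx
  have hga := hg a ha hfa
  have key := hg _ hmem (by simp [hfa]; field_simp; ring)
  simp [hga] at key
  have : g x - e = (f x - c) / (f z - c) * (g z - e) := by linarith
  rw [this]
  ring

theorem rel_iff_of_sign_eq {rel : ℝ → ℝ → Prop}
    (h : rel = (· = ·) ∨ rel = (· < ·) ∨ rel = (· ≤ ·)) {u v c : ℝ}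
    (hs : SignType.sign (u - c) = SignType.sign (v - c)) : rel u c ↔ rel v c := by
  have h1 : u - c = 0 ↔ v - c = 0 := by rw [← sign_eq_zero_iff, hs, sign_eq_zero_iff]
  have h2 : u - c < 0 ↔ v - c < 0 := by rw [← sign_eq_neg_one_iff, hs, sign_eq_neg_one_iff]
  rcases h with rfl | rfl | rfl
  · simpa [sub_eq_zero] using h1
  · simpa using h2
  · change u ≤ c ↔ v ≤ c
    rw [sub_eq_zero, sub_eq_zero] at h1
    rw [sub_neg, sub_neg] at h2
    rw [le_iff_lt_or_eq, le_iff_lt_or_eq, h1, h2]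

theorem eventually_sign_sub_eq {m : ℕ} (g : (Fin m → ℝ) →ₗ[ℝ] ℝ) {e : ℝ} {a : Fin m → ℝ}
    (h : g a ≠ e) :
    ∀ᶠ x in nhds a, SignType.sign (g x - e) = SignType.sign (g a - e) := by
  have hg : Continuous fun x => g x - e :=
    (LinearMap.continuous_of_finiteDimensional g).sub continuous_const
  rcases lt_or_gt_of_ne h with h | h
  · filter_upwards [hg.continuousAt.eventually_lt_const (sub_neg.2 h)] with x hx
    rw [sign_neg hx, sign_neg (sub_neg.2 h)]
  · filter_upwards [hg.continuousAt.eventually_const_lt (sub_pos.2 h)] with x hx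
    rw [sign_pos hx, sign_pos (sub_pos.2 h)]

/-- if `X` is semilinear, `Z = fcl X` is a flat of dimension
`d > 0`, and `H ⊆ Z` is a closed half-flat with
`dim (X ∩ bd(H) ∩ esb(X) ∩ esb(X ∩ H)) = d − 1`, then `H` is essential
for `X`. -/
theorem essential_criterion {m : ℕ} (X : Set (Fin m → ℝ)) (hX : IsSemilinear X)
    (Z : Set (Fin m → ℝ)) (hZ : IsFlat Z) (hfcl : fcl X = Z) (d : ℕ) (hd : 0 < d)
    (hdZ : sldim Z = (d : ℤ))
    (H : Set (Fin m → ℝ)) (hH : IsClosedHalfFlatOf Z H)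
    (hdim : sldim (X ∩ bdIn Z H ∩ esbIn Z X ∩ esbIn Z (X ∩ H)) =
      (((d : ℤ) - 1 : ℤ) : WithBot ℤ)) :
    EssentialFor Z X H := by
  obtain ⟨A, rfl⟩ := hZ.exists_affineSubspace
  obtain ⟨-, hHne, f, c, rfl⟩ := hH
  obtain ⟨z, hzA, hfz⟩ : ∃ z ∈ A, c < f z := by
    by_contra! hall
    exact hHne (Set.ext fun x => ⟨fun hx => hx.1, fun hx => ⟨hx, hall x hx⟩⟩)
  have hXA : X ⊆ A := hfcl ▸ Set.subset_sInter fun C hC => hC.2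
  obtain ⟨B, hB⟩ := exists_affineSubspace_inter_levelSet A f c
  have hBA : B < A := by
    refine SetLike.lt_iff_le_and_exists.2 ⟨fun x hx => ((hB x).1 hx).1, z, hzA, fun hz => ?_⟩
    exact hfz.ne' ((hB z).1 hz).2
  have hAd : Module.finrank ℝ A.direction ≤ d := by
    have := finrank_direction_le_sldim (A := A) ⟨z, hzA⟩
    rw [hdZ, WithBot.coe_le_coe] at this
    exact_mod_cast this
  have hfcont : Continuous f := LinearMap.continuous_of_finiteDimensional f
  obtain ⟨N, T, hT, rfl⟩ := hX
  choose k g e rel hrel hTeq using hT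
  set S := (⋃ j, T j) ∩ bdIn (A : Set (Fin m → ℝ)) {a ∈ (A : Set (Fin m → ℝ)) | f a ≤ c} ∩
    esbIn (A : Set (Fin m → ℝ)) (⋃ j, T j) ∩
    esbIn (A : Set (Fin m → ℝ)) ((⋃ j, T j) ∩ {a ∈ (A : Set (Fin m → ℝ)) | f a ≤ c}) with hS
  have hSB : ∀ x ∈ S, x ∈ B := by
    rintro x ⟨⟨⟨-, hxA, hxbd⟩, -⟩, -⟩
    refine (hB x).2 ⟨hxA, ?_⟩
    by_contra hne
    rcases lt_or_gt_of_ne hne with hlt | hgt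
    · obtain ⟨r, hr, hsub⟩ := Metric.mem_nhds_iff.1 (hfcont.continuousAt.eventually_lt_const hlt)
      obtain ⟨y, hy, hyA, hyH⟩ := (hxbd r hr).2
      rw [cube_eq_ball x hr] at hy
      exact hyH ⟨hyA, (hsub hy).le⟩
    · obtain ⟨r, hr, hsub⟩ := Metric.mem_nhds_iff.1 (hfcont.continuousAt.eventually_const_lt hgt)
      obtain ⟨y, hy, -, hyH⟩ := (hxbd r hr).1
      rw [cube_eq_ball x hr] at hy
      exact (not_lt.2 hyH) (hsub hy)
  have hSd : (((d - 1 : ℕ) : ℤ) : WithBot ℤ) ≤ sldim S := by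
    rw [hdim, Nat.cast_sub hd, Nat.cast_one]
  choose F hF using fun ji : Σ j, Fin (k j) =>
    exists_affineSubspace_inter_levelSet B (g ji.1 ji.2) (e ji.1 ji.2)
  obtain ⟨a, haS, hgen⟩ : ∃ a ∈ S, ∀ ji : Σ j, Fin (k j),
      g ji.1 ji.2 a = e ji.1 ji.2 → ∀ x ∈ B, g ji.1 ji.2 x = e ji.1 ji.2 := by
    by_contra! hall
    obtain ⟨⟨ji, y, hyB, hy⟩, hne, hle⟩ := exists_le_finrank_of_le_sldim hSd
      (fun i : {ji : Σ j, Fin (k j) // ∃ x ∈ B, g ji.1 ji.2 x ≠ e ji.1 ji.2} => F i.1) (by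
        intro x hx
        obtain ⟨ji, hji, y, hyB, hy⟩ := hall x hx
        exact Set.mem_iUnion.2 ⟨⟨ji, y, hyB, hy⟩, (hF ji x).2 ⟨hSB x hx, hji⟩⟩)
    have hFB : F ji < B := SetLike.lt_iff_le_and_exists.2
      ⟨fun x hx => ((hF ji x).1 hx).1, y, hyB, fun hyF => hy ((hF ji y).1 hyF).2⟩
    have h1 := finrank_direction_lt_of_lt hFB hne
    have h2 := finrank_direction_lt_of_lt hBA ⟨y, hyB⟩
    simp only at hle
    omega
  have haB := hSB a haS
  obtain ⟨haA, hfa⟩ := (hB a).1 haB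
  obtain ⟨⟨⟨haX, habd⟩, haesb⟩, haesbH⟩ := haS
  refine ⟨a, habd, ?_⟩
  have hev : ∀ᶠ x in nhds a, ∀ ji : Σ j, Fin (k j), g ji.1 ji.2 a ≠ e ji.1 ji.2 →
      SignType.sign (g ji.1 ji.2 x - e ji.1 ji.2) =
        SignType.sign (g ji.1 ji.2 a - e ji.1 ji.2) := by
    rw [Filter.eventually_all]
    intro ji
    by_cases h : g ji.1 ji.2 a = e ji.1 ji.2
    · exact Filter.Eventually.of_forall fun x hx => absurd h hx
    · exact (eventually_sign_sub_eq _ h).mono fun x hx _ => hx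
  obtain ⟨r, hr, hball⟩ := Metric.mem_nhds_iff.1 hev
  rw [← cube_eq_ball a hr] at hball
  have hopen : IsOpen (cube a r) := cube_eq_ball a hr ▸ Metric.isOpen_ball
  have hacube : a ∈ cube a r := cube_eq_ball a hr ▸ Metric.mem_ball_self hr
  have htransfer : ∀ x ∈ cube a r, ∀ y ∈ cube a r, y ∈ A → x ∈ (⋃ j, T j) →
      SignType.sign (f x - c) = SignType.sign (f y - c) → y ∈ ⋃ j, T j := by
    intro x hx y hy hyA hxX hsign
    have hxA : x ∈ A := hXA hxX
    obtain ⟨j, hj⟩ := Set.mem_iUnion.1 hxX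
    refine Set.mem_iUnion.2 ⟨j, ?_⟩
    rw [hTeq j] at hj ⊢
    intro i
    refine (rel_iff_of_sign_eq (hrel j i) ?_).1 (hj i)
    by_cases hga : g j i a = e j i
    · obtain ⟨μ, hμ⟩ := exists_sub_eq_mul_sub haA hfa hzA hfz
        fun x hxA hfx => hgen ⟨j, i⟩ hga x ((hB x).2 ⟨hxA, hfx⟩)
      rw [hμ x hxA, hμ y hyA, sign_mul, sign_mul, hsign]
    · exact (hball hx ⟨j, i⟩ hga).trans (hball hy ⟨j, i⟩ hga).symm
  obtain ⟨w, hw, hwX, hwf⟩ : ∃ w ∈ cube a r, w ∈ (⋃ j, T j) ∧ f w < c := by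
    by_contra! hall
    have hle := sldimAt_le (S := (A : Set (Fin m → ℝ)) ∩
      ((⋃ j, T j) ∩ {a ∈ (A : Set (Fin m → ℝ)) | f a ≤ c})) hopen hacube
    rw [haesbH.2.1, hdZ] at hle
    obtain ⟨-, -, hdB⟩ := exists_le_finrank_of_le_sldim hle (fun _ : Unit => B) (by
      rintro x ⟨hx, hxA, hxX, -, hxf⟩
      exact Set.mem_iUnion.2 ⟨(), (hB x).2 ⟨hxA, hxf.antisymm (hall x hx hxX)⟩⟩)
    have := finrank_direction_lt_of_lt hBA ⟨a, haB⟩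
    omega
  have hlower : ∀ y ∈ cube a r, y ∈ A → f y ≤ c → y ∈ ⋃ j, T j := by
    intro y hy hyA hyf
    rcases hyf.lt_or_eq with hlt | heq
    · exact htransfer w hw y hy hyA hwX (by rw [sign_neg (sub_neg.2 hwf), sign_neg (sub_neg.2 hlt)])
    · exact htransfer a hacube y hy hyA haX (by rw [hfa, heq])
  refine ⟨r, hr, Set.ext fun x => ⟨fun ⟨hxX, hx⟩ => ⟨⟨hXA hxX, ?_⟩, hx⟩,
    fun ⟨⟨hxA, hxf⟩, hx⟩ => ⟨hlower x hx hxA hxf, hx⟩⟩⟩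
  by_contra! hxf
  have hle := sldimAt_le (S := (A : Set (Fin m → ℝ)) \ ⋃ j, T j) hopen hacube
  have hempty : cube a r ∩ ((A : Set (Fin m → ℝ)) \ ⋃ j, T j) = ∅ := by
    refine Set.eq_empty_of_forall_notMem ?_
    rintro y ⟨hy, hyA, hyX⟩
    refine hyX ?_
    rcases le_or_gt (f y) c with hyf | hyf
    · exact hlower y hy hyA hyf
    · exact htransfer x hx y hy hyA hxX (by rw [sign_pos (sub_pos.2 hxf), sign_pos (sub_pos.2 hyf)])
  rw [haesb.2.2.1, hdZ, hempty, sldim, if_pos rfl] at hle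
  exact WithBot.coe_ne_bot (le_bot_iff.1 hle)
end
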